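/- (Lemma sigmai) Let Ω₀ be a p×p matrix and Ω₁, Ω₂ be matrices differing from Ω₀ only in the first row and first column, with Ω_i − Ω₀ of the form: first row equal to (0, r_i) and first column (0, r_i)^T where r_i ∈ {0, ε}^{p−1} has exactly k nonzero entries, zero elsewhere. Let J be the number of coordinates where both r₁ and r₂ equal ε. Then Q = (Ω₂ − Ω₀)(Ω₁ − Ω₀) satisfies: Q_{11} = Jε², Q_{ij} = ε² exactly when i ∈ supp(r₂)+1 and j ∈ supp(r₁)+1, and Q_{ij} = 0 otherwise; moreover Q has rank at most 2 and its nonzero eigenvalues are both equal to Jε² (when J ≥ 1). -/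

import Mathlib

open Matrix Polynomial

/-- The first standard basis vector `e₁` of `ℝ^{p+2}`. -/
def e₁ (p : ℕ) : Fin (p + 2) → ℝ := fun i => if i = 0 then 1 else 0

/-- Lemma sigmai: with `Ωᵢ − Ω₀ = e₁uᵀ + ue₁ᵀ` (resp. `v`), where
`u, v` vanish in the first coordinate, have entries in `{0, ε}` with exactly `k`
entries equal to `ε`, and `J` overlapping `ε`'s, the product
`Q = (Ω₂ − Ω₀)(Ω₁ − Ω₀)` satisfies `Q₁₁ = Jε²`, `Q_{ij} = ε²` exactly for
`i ∈ supp v`, `j ∈ supp u` (off the first row/column, which is otherwise zero),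
and `Q` has rank at most `2` with both nonzero eigenvalues equal to `Jε²`
(expressed via the characteristic polynomial). -/
theorem stmt13 {p k : ℕ} (hk : 1 ≤ k) (ε : ℝ) (hε : 0 < ε)
    (u v : Fin (p + 2) → ℝ) (hu0 : u 0 = 0) (hv0 : v 0 = 0)
    (hu : ∀ i, u i = 0 ∨ u i = ε) (hv : ∀ i, v i = 0 ∨ v i = ε)
    (hku : (Finset.univ.filter fun i => u i ≠ 0).card = k)
    (hkv : (Finset.univ.filter fun i => v i ≠ 0).card = k)
    (J : ℕ)
    (hJ : J = ((Finset.univ.filter fun i => v i ≠ 0) ∩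
      (Finset.univ.filter fun i => u i ≠ 0)).card)
    (Q : Matrix (Fin (p + 2)) (Fin (p + 2)) ℝ)
    (hQ : Q = (Matrix.of fun i j => e₁ p i * v j + v i * e₁ p j) *
              (Matrix.of fun i j => e₁ p i * u j + u i * e₁ p j)) :
    Q 0 0 = J * ε ^ 2 ∧
    (∀ i j, i ≠ 0 → j ≠ 0 →
      Q i j = if v i ≠ 0 ∧ u j ≠ 0 then ε ^ 2 else 0) ∧
    (∀ j, j ≠ 0 → Q 0 j = 0 ∧ Q j 0 = 0) ∧
    Q.rank ≤ 2 ∧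
    Q.charpoly = X ^ p * (X - C ((J : ℝ) * ε ^ 2)) ^ 2 := by
  set S : ℝ := ∑ i, v i * u i with hSdef
  have hS : S = J * ε ^ 2 := by
    rw [hSdef, hJ, ← Finset.filter_and, Finset.card_filter]
    push_cast
    rw [Finset.sum_mul]
    refine Finset.sum_congr rfl fun i _ => ?_
    rcases hu i with h | h <;> rcases hv i with h' | h' <;>
      simp [h, h', hε.ne', sq]
  have hent : ∀ i j, Q i j = S * e₁ p i * e₁ p j + v i * u j := by
    intro i j
    have h1 : ∀ x : Fin (p + 2), (e₁ p i * v x + v i * e₁ p x) * (e₁ p x * u j + u x * e₁ p j)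
        = (v x * u x) * (e₁ p i * e₁ p j) + (if x = 0 then v i * u j else 0) := by
      intro x
      by_cases hx : x = 0
      · subst hx
        simp [e₁, hu0, hv0]
      · simp [e₁, hx]
    rw [hQ, Matrix.mul_apply]
    simp only [Matrix.of_apply, h1]
    rw [Finset.sum_add_distrib, ← Finset.sum_mul, Finset.sum_ite_eq' Finset.univ (0 : Fin (p + 2))]
    simp [hSdef, mul_assoc]
  let A : Matrix (Fin (p + 2)) (Fin 2) ℝ := Matrix.of fun i => ![e₁ p i, v i]
  let B : Matrix (Fin 2) (Fin (p + 2)) ℝ := Matrix.of ![fun j => S * e₁ p j, u]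
  have hAB : Q = A * B := by
    ext i j
    rw [hent, Matrix.mul_apply, Fin.sum_univ_two]
    simp [A, B]
    ring
  have hBA : B * A = Matrix.diagonal (fun _ => S) := by
    ext i j
    rw [Matrix.mul_apply]
    fin_cases i <;> fin_cases j
    · simp [A, B, e₁]
    · simp [A, B, e₁, hv0]
    · simp [A, B, e₁, hu0]
    · simp [A, B, hSdef, mul_comm]
  refine ⟨?_, ?_, ?_, ?_, ?_⟩
  · rw [hent, ← hS]
    simp [e₁, hu0]
  · intro i j hi hj
    rw [hent]
    rcases hu j with h | h <;> rcases hv i with h' | h' <;>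
      simp [h, h', hε.ne', sq, e₁, hi]
  · intro j hj
    simp [hent, e₁, hj, hu0, hv0]
  · rw [hAB]
    refine (Matrix.rank_mul_le_left A B).trans ?_
    simpa using Matrix.rank_le_card_width A
  · rw [hAB, Matrix.charpoly_mul_comm_of_le A B (by simp), hBA, Matrix.charpoly_diagonal, ← hS]
    simp
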